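/- Let n ≥ 2, d ≥ 2, and let L₁, …, L_n be n pairwise distinct lines through the origin in ℝ^d. For each j let g_j : ℝ^d → ℝ^d denote the orthogonal projection onto the orthogonal complement of L_j. Then there exists a constant M > 0 (depending only on the lines) such that for all nonempty subsets A, B of ℝ^d of cardinality at most n−1, d_H(A, B) ≤ M · max_{1 ≤ j ≤ n} d_H(g_j(A), g_j(B)), where g_j(A) = {g_j(a) : a ∈ A}. -/

import Mathlib

open Metric

/-- Two distinct lines: the two projections jointly control the norm. -/
theorem proj_pair_bound {E : Type*} [NormedAddCommGroup E] [InnerProductSpace ℝ E]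
    [FiniteDimensional ℝ E] (L K : Submodule ℝ E)
    (hL : Module.finrank ℝ L = 1) (hK : Module.finrank ℝ K = 1) (hne : L ≠ K) :
    ∃ C : ℝ, 0 ≤ C ∧ ∀ (v : E) (δ : ℝ),
      ‖(Submodule.orthogonalProjectionOnto Lᗮ v : E)‖ ≤ δ →
      ‖(Submodule.orthogonalProjectionOnto Kᗮ v : E)‖ ≤ δ → ‖v‖ ≤ C * δ := by
  let f : E →ₗ[ℝ] (Lᗮ × Kᗮ) :=
    LinearMap.prod (Submodule.orthogonalProjectionOnto Lᗮ).toLinearMap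
      (Submodule.orthogonalProjectionOnto Kᗮ).toLinearMap
  have hker : LinearMap.ker f = ⊥ := by
    rw [LinearMap.ker_eq_bot']
    intro x hx
    have h1 : Submodule.orthogonalProjectionOnto Lᗮ x = 0 := congrArg Prod.fst hx
    have h2 : Submodule.orthogonalProjectionOnto Kᗮ x = 0 := congrArg Prod.snd hx
    rw [Submodule.orthogonalProjectionOnto_eq_zero_iff, Submodule.orthogonal_orthogonal] at h1 h2
    by_contra hx0
    apply hne
    have key : ∀ S : Submodule ℝ E, Module.finrank ℝ S = 1 → x ∈ S →
        Submodule.span ℝ {x} = S := by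
      intro S hS hxS
      apply Submodule.eq_of_le_of_finrank_eq
      · rw [Submodule.span_le]; simpa using hxS
      · rw [hS, finrank_span_singleton hx0]
    rw [← key L hL h1, ← key K hK h2]
  obtain ⟨C, _, hC⟩ := f.exists_antilipschitzWith hker
  refine ⟨C, C.2, fun v δ h1 h2 => ?_⟩
  have h := hC.le_mul_dist v 0
  rw [map_zero, dist_zero_right, dist_zero_right] at h
  refine h.trans (mul_le_mul_of_nonneg_left ?_ C.2)
  rw [Prod.norm_def]
  exact max_le h1 h2

/-- For finite sets, every point of `A` has a partner in `B` within the Hausdorff distance. -/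
theorem exists_partner {E F : Type*} [PseudoMetricSpace F] (g : E → F)
    {A B : Set E} (hA : A.Finite) (hB : B.Finite) (hBn : B.Nonempty) {a : E} (ha : a ∈ A) :
    ∃ b ∈ B, dist (g a) (g b) ≤ hausdorffDist (g '' A) (g '' B) := by
  have hfin : hausdorffEDist (g '' A) (g '' B) ≠ ⊤ :=
    hausdorffEDist_ne_top_of_nonempty_of_bounded ⟨_, a, ha, rfl⟩ (hBn.image g)
      (hA.image g).isBounded (hB.image g).isBounded
  obtain ⟨_, ⟨b, hb, rfl⟩, hy⟩ := (hB.image g).isCompact.exists_infDist_eq_dist (hBn.image g) (g a)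
  refine ⟨b, hb, ?_⟩
  rw [← hy]
  exact infDist_le_hausdorffDist_of_mem ⟨a, ha, rfl⟩ hfin

/-- **Lemma (projections recover finite sets).** Given `n` pairwise distinct lines through
the origin in `ℝ^d` and the orthogonal projections `g_j` onto their orthogonal complements,
there is a constant `M > 0` such that the Hausdorff distance between any two sets of at most
`n-1` points is controlled by the largest Hausdorff distance between their projections. -/
theorem hausdorffDist_le_of_projections (n d : ℕ) (hn : 2 ≤ n) (hd : 2 ≤ d)
    (ℓ : Fin n → Submodule ℝ (EuclideanSpace ℝ (Fin d)))
    (hrank : ∀ j, Module.finrank ℝ (ℓ j) = 1)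
    (hdistinct : Function.Injective ℓ) :
    ∃ M : ℝ, 0 < M ∧
      ∀ A B : Set (EuclideanSpace ℝ (Fin d)),
        A.Nonempty → A.Finite → A.ncard ≤ n - 1 →
        B.Nonempty → B.Finite → B.ncard ≤ n - 1 →
        hausdorffDist A B ≤ M * ⨆ j : Fin n,
          hausdorffDist
            ((fun x => (Submodule.orthogonalProjectionOnto (ℓ j)ᗮ x : EuclideanSpace ℝ (Fin d))) '' A)
            ((fun x => (Submodule.orthogonalProjectionOnto (ℓ j)ᗮ x : EuclideanSpace ℝ (Fin d))) '' B) := by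
  classical
  have hp : ∀ p : Fin n × Fin n, ∃ C : ℝ, 0 ≤ C ∧ (p.1 ≠ p.2 →
      ∀ (v : EuclideanSpace ℝ (Fin d)) (δ : ℝ),
      ‖(Submodule.orthogonalProjectionOnto (ℓ p.1)ᗮ v : EuclideanSpace ℝ (Fin d))‖ ≤ δ →
      ‖(Submodule.orthogonalProjectionOnto (ℓ p.2)ᗮ v : EuclideanSpace ℝ (Fin d))‖ ≤ δ →
      ‖v‖ ≤ C * δ) := by
    intro p
    by_cases h : p.1 = p.2
    · exact ⟨0, le_rfl, fun h' => absurd h h'⟩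
    · obtain ⟨C, hC, hb⟩ := proj_pair_bound (ℓ p.1) (ℓ p.2) (hrank _) (hrank _)
        (fun e => h (hdistinct e))
      exact ⟨C, hC, fun _ => hb⟩
  choose C hC0 hC using hp
  have hS : 0 ≤ ∑ p, C p := Finset.sum_nonneg fun p _ => hC0 p
  refine ⟨(∑ p, C p) + 1, by linarith, ?_⟩
  have half : ∀ (A B : Set (EuclideanSpace ℝ (Fin d))) (δ : ℝ), A.Finite → B.Finite →
      B.Nonempty → B.ncard ≤ n - 1 → 0 ≤ δ →
      (∀ j, hausdorffDist
        ((fun x => (Submodule.orthogonalProjectionOnto (ℓ j)ᗮ x : EuclideanSpace ℝ (Fin d))) '' A)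
        ((fun x => (Submodule.orthogonalProjectionOnto (ℓ j)ᗮ x : EuclideanSpace ℝ (Fin d))) '' B)
          ≤ δ) →
      ∀ a ∈ A, ∃ b ∈ B, dist a b ≤ ((∑ p, C p) + 1) * δ := by
    intro A B δ hA hB hBn hcard hδ hj a ha
    choose b hbB hb using fun j => exists_partner
      (fun x => (Submodule.orthogonalProjectionOnto (ℓ j)ᗮ x : EuclideanSpace ℝ (Fin d)))
      hA hB hBn ha
    have hlt : hB.toFinset.card < (Finset.univ : Finset (Fin n)).card := by
      rw [← Set.ncard_eq_toFinset_card B hB, Finset.card_univ, Fintype.card_fin]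
      omega
    obtain ⟨j, -, k, -, hjk, hbb⟩ := Finset.exists_ne_map_eq_of_card_lt_of_maps_to hlt
      (f := b) (fun j _ => by simpa using hbB j)
    have hbound : ∀ i, ‖(Submodule.orthogonalProjectionOnto (ℓ i)ᗮ (a - b i) :
        EuclideanSpace ℝ (Fin d))‖ ≤ δ := by
      intro i
      have h := (hb i).trans (hj i)
      rw [dist_eq_norm] at h
      rw [map_sub, Submodule.coe_sub]
      exact h
    refine ⟨b j, hbB j, ?_⟩
    rw [dist_eq_norm]
    refine (hC (j, k) hjk _ δ (hbound j) (hbb ▸ hbound k)).trans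
      (mul_le_mul_of_nonneg_right ?_ hδ)
    have := Finset.single_le_sum (f := C) (fun p _ => hC0 p) (Finset.mem_univ (j, k))
    linarith
  intro A B hAn hA hAc hBn hB hBc
  set φ : Fin n → ℝ := fun j => hausdorffDist
    ((fun x => (Submodule.orthogonalProjectionOnto (ℓ j)ᗮ x : EuclideanSpace ℝ (Fin d))) '' A)
    ((fun x => (Submodule.orthogonalProjectionOnto (ℓ j)ᗮ x : EuclideanSpace ℝ (Fin d))) '' B)
    with hφ
  have hle : ∀ j, φ j ≤ ⨆ j, φ j := fun j => le_ciSup (Set.finite_range φ).bddAbove j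
  have hδ : 0 ≤ ⨆ j, φ j := Real.iSup_nonneg fun j => hausdorffDist_nonneg
  refine hausdorffDist_le_of_mem_dist (mul_nonneg (by linarith) hδ)
    (half A B _ hA hB hBn hBc hδ hle) (half B A _ hB hA hAn hAc hδ fun j => ?_)
  rw [hausdorffDist_comm]
  exact hle j
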